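/- Let x^(0) ∈ (ℝ^d)^N be arbitrary and, for t ≥ 0, obtain x^(t+1) from x^(t) by one full sweep of cyclic exact coordinate minimization: for i = 1,…,N in order, replace the i-th coordinate by (I + Σ_{j≠i} w_{ij})⁻¹ (z_i + Σ_{j≠i} w_{ij} x_j), always using the most recently updated values of the other coordinates. Then the sequence x^(t) converges, as t → ∞, to the unique global minimizer x* of E (the coordinate-descent algorithm attains the global minimum of the convex energy, as claimed after Eq. (8) of the paper). -/

import Mathlib

open Matrix Finset

/-- The continuous quadratic energy of the point cloud features:
`E(x) = Σ_i ‖x_i − z_i‖² + (1/2) Σ_{i≠j} (x_i − x_j)ᵀ w_{ij} (x_i − x_j)`. -/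
noncomputable def energy {N d : ℕ} (z : Fin N → Fin d → ℝ)
    (w : Fin N → Fin N → Matrix (Fin d) (Fin d) ℝ)
    (x : Fin N → Fin d → ℝ) : ℝ :=
  ∑ i, (x i - z i) ⬝ᵥ (x i - z i) +
    (1 / 2 : ℝ) * ∑ i, ∑ j ∈ univ.erase i, (x i - x j) ⬝ᵥ (w i j) *ᵥ (x i - x j)

/-- The coordinate-descent update `(I + Σ_{j≠i} w_{ij})⁻¹ (z_i + Σ_{j≠i} w_{ij} x_j)`
(Eq. (8) of the paper). -/
noncomputable def coordUpdate {N d : ℕ} (z : Fin N → Fin d → ℝ)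
    (w : Fin N → Fin N → Matrix (Fin d) (Fin d) ℝ)
    (i : Fin N) (x : Fin N → Fin d → ℝ) : Fin d → ℝ :=
  (1 + ∑ j ∈ univ.erase i, w i j)⁻¹ *ᵥ (z i + ∑ j ∈ univ.erase i, (w i j) *ᵥ x j)

/-- One full sweep of cyclic exact coordinate minimization: for `i = 1,…,N` in order,
replace the `i`-th coordinate by its exact minimizer, always using the most recently
updated values of the other coordinates. -/
noncomputable def sweep {N d : ℕ} (z : Fin N → Fin d → ℝ)
    (w : Fin N → Fin N → Matrix (Fin d) (Fin d) ℝ)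
    (x : Fin N → Fin d → ℝ) : Fin N → Fin d → ℝ :=
  (List.finRange N).foldl (fun y i => Function.update y i (coordUpdate z w i y)) x


/-- Half the gradient. -/
noncomputable def halfGrad {N d : ℕ} (z : Fin N → Fin d → ℝ)
    (w : Fin N → Fin N → Matrix (Fin d) (Fin d) ℝ)
    (x : Fin N → Fin d → ℝ) (i : Fin N) : Fin d → ℝ :=
  (x i - z i) + ∑ j, (w i j) *ᵥ (x i - x j)

theorem energy_eq {N d : ℕ} (z : Fin N → Fin d → ℝ)
    (w : Fin N → Fin N → Matrix (Fin d) (Fin d) ℝ)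
    (x : Fin N → Fin d → ℝ) : energy z w x = ∑ i, (x i - z i) ⬝ᵥ (x i - z i) +
    (1 / 2 : ℝ) * ∑ i, ∑ j, (x i - x j) ⬝ᵥ (w i j) *ᵥ (x i - x j) := by
  unfold energy
  congr 2
  refine Finset.sum_congr rfl fun i _ => ?_
  apply Finset.sum_erase
  simp

theorem energy_add {N d : ℕ} (z : Fin N → Fin d → ℝ)
    (w : Fin N → Fin N → Matrix (Fin d) (Fin d) ℝ)
    (hpsd : ∀ i j, i ≠ j → (w i j).PosSemidef)
    (hsymm : ∀ i j, w i j = w j i) (x h : Fin N → Fin d → ℝ) :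
    energy z w (x + h) = energy z w x + 2 * ∑ i, h i ⬝ᵥ halfGrad z w x i + energy 0 w h := by
  have h1 : ∀ i, ((x + h) i - z i) ⬝ᵥ ((x + h) i - z i) = (x i - z i) ⬝ᵥ (x i - z i)
      + 2 * (h i ⬝ᵥ (x i - z i)) + (h i - (0 : Fin N → Fin d → ℝ) i) ⬝ᵥ (h i - (0 : Fin N → Fin d → ℝ) i) := by
    intro i
    have : (x + h) i - z i = (x i - z i) + h i := by simp; abel
    rw [this]
    simp only [Pi.zero_apply, sub_zero, add_dotProduct, dotProduct_add]
    rw [dotProduct_comm (x i - z i) (h i)]; ring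
  have h2 : ∀ i j, ((x + h) i - (x + h) j) ⬝ᵥ (w i j) *ᵥ ((x + h) i - (x + h) j)
      = (x i - x j) ⬝ᵥ (w i j) *ᵥ (x i - x j) + 2 * (h i ⬝ᵥ (w i j) *ᵥ (x i - x j))
        + 2 * (h j ⬝ᵥ (w j i) *ᵥ (x j - x i)) + (h i - h j) ⬝ᵥ (w i j) *ᵥ (h i - h j) := by
    intro i j
    by_cases hij : i = j
    · subst hij; simp
    have hw : (w i j)ᵀ = w i j := by
      have := (hpsd i j hij).isHermitian
      simpa [Matrix.IsHermitian, conjTranspose_eq_transpose_of_trivial] using this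
    have e : (x + h) i - (x + h) j = (x i - x j) + (h i - h j) := by simp; abel
    have c : (x i - x j) ⬝ᵥ (w i j) *ᵥ (h i - h j) = (h i - h j) ⬝ᵥ (w i j) *ᵥ (x i - x j) := by
      rw [dotProduct_mulVec, ← mulVec_transpose, hw, dotProduct_comm]
    have e2 : h j ⬝ᵥ (w j i) *ᵥ (x j - x i) = - (h j ⬝ᵥ (w i j) *ᵥ (x i - x j)) := by
      rw [← hsymm i j, ← neg_sub (x i) (x j), mulVec_neg, dotProduct_neg]
    have e3 : (h i - h j) ⬝ᵥ (w i j) *ᵥ (x i - x j) =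
      h i ⬝ᵥ (w i j) *ᵥ (x i - x j) - h j ⬝ᵥ (w i j) *ᵥ (x i - x j) := sub_dotProduct _ _ _
    rw [e, mulVec_add, dotProduct_add, add_dotProduct, add_dotProduct, c, e2, e3]; ring
  have h3 : ∀ i, h i ⬝ᵥ halfGrad z w x i =
      h i ⬝ᵥ (x i - z i) + ∑ j, h i ⬝ᵥ (w i j) *ᵥ (x i - x j) := by
    intro i
    rw [halfGrad, dotProduct_add, dotProduct_sum]
  have h4 : ∑ i, ∑ j, h j ⬝ᵥ (w j i) *ᵥ (x j - x i) = ∑ i, ∑ j, h i ⬝ᵥ (w i j) *ᵥ (x i - x j) :=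
    Finset.sum_comm
  simp only [energy_eq, h1, h2, h3, Finset.sum_add_distrib, ← Finset.mul_sum, h4]
  ring

theorem sum_sq_le_energy {N d : ℕ} (z : Fin N → Fin d → ℝ)
    (w : Fin N → Fin N → Matrix (Fin d) (Fin d) ℝ)
    (hpsd : ∀ i j, i ≠ j → (w i j).PosSemidef) (x : Fin N → Fin d → ℝ) :
    ∑ i, (x i - z i) ⬝ᵥ (x i - z i) ≤ energy z w x := by
  unfold energy
  have : 0 ≤ ∑ i, ∑ j ∈ univ.erase i, (x i - x j) ⬝ᵥ (w i j) *ᵥ (x i - x j) := by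
    refine Finset.sum_nonneg fun i _ => Finset.sum_nonneg fun j hj => ?_
    have := (hpsd i j (Finset.ne_of_mem_erase hj).symm).dotProduct_mulVec_nonneg (x i - x j)
    simpa using this
  linarith

theorem coord_sq_le_energy {N d : ℕ} (z : Fin N → Fin d → ℝ)
    (w : Fin N → Fin N → Matrix (Fin d) (Fin d) ℝ)
    (hpsd : ∀ i j, i ≠ j → (w i j).PosSemidef) (x : Fin N → Fin d → ℝ) (i : Fin N) (k : Fin d) :
    (x i k - z i k) ^ 2 ≤ energy z w x := by
  refine le_trans ?_ (sum_sq_le_energy z w hpsd x)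
  have a : (x i k - z i k) ^ 2 ≤ (x i - z i) ⬝ᵥ (x i - z i) := by
    unfold dotProduct
    have := Finset.single_le_sum (f := fun k => (x i - z i) k * (x i - z i) k)
      (fun k _ => mul_self_nonneg _) (Finset.mem_univ k)
    simpa [sq] using this
  refine a.trans (Finset.single_le_sum (f := fun i => (x i - z i) ⬝ᵥ (x i - z i)) (fun i _ => ?_)
    (Finset.mem_univ i))
  exact Finset.sum_nonneg fun k _ => mul_self_nonneg _

theorem energy_zero_nonneg {N d : ℕ}
    (w : Fin N → Fin N → Matrix (Fin d) (Fin d) ℝ)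
    (hpsd : ∀ i j, i ≠ j → (w i j).PosSemidef) (h : Fin N → Fin d → ℝ) :
    0 ≤ energy 0 w h := 
  le_trans (Finset.sum_nonneg fun i _ => Finset.sum_nonneg fun k _ => mul_self_nonneg _)
    (sum_sq_le_energy 0 w hpsd h)

theorem eq_zero_of_energy {N d : ℕ}
    (w : Fin N → Fin N → Matrix (Fin d) (Fin d) ℝ)
    (hpsd : ∀ i j, i ≠ j → (w i j).PosSemidef) (h : Fin N → Fin d → ℝ)
    (h0 : energy 0 w h ≤ 0) : h = 0 := by
  funext i k
  have := coord_sq_le_energy 0 w hpsd h i k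
  simp only [Pi.zero_apply, sub_zero] at this ⊢
  nlinarith

theorem halfGrad_update {N d : ℕ} (z : Fin N → Fin d → ℝ)
    (w : Fin N → Fin N → Matrix (Fin d) (Fin d) ℝ)
    (hpsd : ∀ i j, i ≠ j → (w i j).PosSemidef) (x : Fin N → Fin d → ℝ) (i : Fin N) :
    halfGrad z w (Function.update x i (coordUpdate z w i x)) i = 0 := by
  have hA : (1 + ∑ j ∈ univ.erase i, w i j).PosDef := by
    apply Matrix.PosDef.add_posSemidef Matrix.PosDef.one
    exact Matrix.posSemidef_sum _ fun j hj => hpsd i j (Finset.ne_of_mem_erase hj).symm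
  have hu : IsUnit (1 + ∑ j ∈ univ.erase i, w i j).det := (Matrix.isUnit_iff_isUnit_det _).1 hA.isUnit
  have key : (1 + ∑ j ∈ univ.erase i, w i j) *ᵥ coordUpdate z w i x
      = z i + ∑ j ∈ univ.erase i, (w i j) *ᵥ x j := by
    rw [coordUpdate, mulVec_mulVec, Matrix.mul_nonsing_inv _ hu, one_mulVec]
  generalize coordUpdate z w i x = u at key
  rw [halfGrad, ← Finset.sum_erase (s := univ) (a := i) (h := by simp)]
  have : ∀ j ∈ univ.erase i, w i j *ᵥ (Function.update x i u i - Function.update x i u j)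
      = w i j *ᵥ u - w i j *ᵥ x j := by
    intro j hj
    rw [Function.update_self, Function.update_of_ne (Finset.ne_of_mem_erase hj), mulVec_sub]
  rw [Finset.sum_congr rfl this, Finset.sum_sub_distrib, Function.update_self]
  rw [add_mulVec, one_mulVec, sum_mulVec] at key
  rw [← sub_eq_zero] at key
  rw [← key]; abel

theorem energy_update {N d : ℕ} (z : Fin N → Fin d → ℝ)
    (w : Fin N → Fin N → Matrix (Fin d) (Fin d) ℝ)
    (hpsd : ∀ i j, i ≠ j → (w i j).PosSemidef)
    (hsymm : ∀ i j, w i j = w j i) (x : Fin N → Fin d → ℝ) (i : Fin N) :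
    energy z w x = energy z w (Function.update x i (coordUpdate z w i x)) +
      energy 0 w (x - Function.update x i (coordUpdate z w i x)) := by
  have hg := halfGrad_update z w hpsd x i
  set y := Function.update x i (coordUpdate z w i x) with hy
  have := energy_add z w hpsd hsymm y (x - y)
  rw [add_sub_cancel] at this
  rw [this, Finset.sum_eq_zero]
  · ring
  intro j _
  by_cases hj : j = i
  · subst hj; rw [hg]; simp
  · rw [hy, Pi.sub_apply, Function.update_of_ne hj]; simp

theorem foldl_energy {N d : ℕ} (z : Fin N → Fin d → ℝ)
    (w : Fin N → Fin N → Matrix (Fin d) (Fin d) ℝ)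
    (hpsd : ∀ i j, i ≠ j → (w i j).PosSemidef)
    (hsymm : ∀ i j, w i j = w j i) (l : List (Fin N)) : ∀ x : Fin N → Fin d → ℝ,
    energy z w (l.foldl (fun y i => Function.update y i (coordUpdate z w i y)) x) ≤ energy z w x ∧
    (energy z w (l.foldl (fun y i => Function.update y i (coordUpdate z w i y)) x) = energy z w x →
      ∀ i ∈ l, halfGrad z w x i = 0) := by
  induction l with
  | nil => intro x; simp
  | cons i l ih =>
    intro x
    rw [List.foldl_cons]
    have hg := halfGrad_update z w hpsd x i
    have he := energy_update z w hpsd hsymm x i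
    set y := Function.update x i (coordUpdate z w i x) with hy
    have hn := energy_zero_nonneg w hpsd (x - y)
    obtain ⟨i1, i2⟩ := ih y
    refine ⟨by linarith, fun heq => ?_⟩
    have hxy : x = y := sub_eq_zero.1 (eq_zero_of_energy w hpsd (x - y) (by linarith))
    intro j hj
    rcases List.mem_cons.1 hj with rfl | hj
    · rw [hxy]; exact hg
    · rw [hxy]; exact i2 (by linarith) j hj

theorem exists_crit {N d : ℕ} (z : Fin N → Fin d → ℝ)
    (w : Fin N → Fin N → Matrix (Fin d) (Fin d) ℝ)
    (hpsd : ∀ i j, i ≠ j → (w i j).PosSemidef)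
    (hsymm : ∀ i j, w i j = w j i) : ∃ x, ∀ i, halfGrad z w x i = 0 := by
  let L : (Fin N → Fin d → ℝ) →ₗ[ℝ] (Fin N → Fin d → ℝ) :=
    { toFun := fun x => halfGrad 0 w x
      map_add' := by
        intro x y
        funext i
        have : ∀ j, x i + y i - (x j + y j) = (x i - x j) + (y i - y j) := by
          intro j; abel
        simp only [halfGrad, Pi.add_apply, Pi.zero_apply, sub_zero]
        simp only [this, mulVec_add, Finset.sum_add_distrib]
        abel
      map_smul' := by
        intro c x
        funext i
        have : ∀ j, c • x i - c • x j = c • (x i - x j) := by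
          intro j; rw [smul_sub]
        simp only [halfGrad, Pi.smul_apply, Pi.zero_apply, sub_zero, smul_add, RingHom.id_apply]
        simp only [this, mulVec_smul, ← Finset.smul_sum] }
  have hinj : Function.Injective L := by
    rw [injective_iff_map_eq_zero]
    intro h hh
    have hh' : halfGrad 0 w h = 0 := hh
    have := energy_add 0 w hpsd hsymm h (-h)
    rw [hh', add_neg_cancel] at this
    have e0 : energy 0 w (0 : Fin N → Fin d → ℝ) = 0 := by simp [energy]
    simp only [e0, Pi.zero_apply, dotProduct_zero, Finset.sum_const_zero, mul_zero, add_zero] at this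
    exact eq_zero_of_energy w hpsd h (by linarith [energy_zero_nonneg w hpsd (-h)])
  obtain ⟨x, hx⟩ := (LinearMap.injective_iff_surjective.1 hinj) z
  refine ⟨x, fun i => ?_⟩
  have : halfGrad 0 w x i = z i := congrFun hx i
  rw [← sub_eq_zero] at this
  rw [← this]
  simp only [halfGrad, Pi.zero_apply]
  abel

theorem continuous_energy {N d : ℕ} (z : Fin N → Fin d → ℝ)
    (w : Fin N → Fin N → Matrix (Fin d) (Fin d) ℝ) : Continuous (energy z w) := by
  unfold energy dotProduct mulVec dotProduct
  fun_prop

theorem continuous_sweep {N d : ℕ} (z : Fin N → Fin d → ℝ)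
    (w : Fin N → Fin N → Matrix (Fin d) (Fin d) ℝ) : Continuous (sweep z w) := by
  unfold sweep
  generalize List.finRange N = l
  induction l with
  | nil => exact continuous_id
  | cons i l ih =>
    simp only [List.foldl_cons]
    refine ih.comp ?_
    refine continuous_id.update i ?_
    unfold coordUpdate
    refine Continuous.matrix_mulVec continuous_const ?_
    refine continuous_const.add (continuous_finsetSum _ fun j _ => ?_)
    exact Continuous.matrix_mulVec continuous_const (continuous_apply j)

/-- Starting from any `x⁰`, the iterates of full sweeps of cyclic exact coordinate
minimization converge to the unique global minimizer of the energy `E`. -/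
theorem stmt_8 {N d : ℕ} (hN : 0 < N) (hd : 0 < d)
    (z : Fin N → Fin d → ℝ)
    (w : Fin N → Fin N → Matrix (Fin d) (Fin d) ℝ)
    (hpsd : ∀ i j, i ≠ j → (w i j).PosSemidef)
    (hsymm : ∀ i j, w i j = w j i)
    (x0 : Fin N → Fin d → ℝ) :
    ∃ xstar : Fin N → Fin d → ℝ,
      (∀ y, energy z w xstar ≤ energy z w y) ∧
      (∀ m : Fin N → Fin d → ℝ, (∀ y, energy z w m ≤ energy z w y) → m = xstar) ∧
      Filter.Tendsto (fun t : ℕ => (sweep z w)^[t] x0) Filter.atTop (nhds xstar) := by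
  obtain ⟨xs, hxs⟩ := exists_crit z w hpsd hsymm
  have hE : ∀ y x, (∀ i, halfGrad z w x i = 0) → energy z w y = energy z w x + energy 0 w (y - x) := by
    intro y x hx
    have := energy_add z w hpsd hsymm x (y - x)
    simpa [hx] using this
  have hmin : ∀ y, energy z w xs ≤ energy z w y := fun y => by
    linarith [hE y xs hxs, energy_zero_nonneg w hpsd (y - xs)]
  have huniq : ∀ m : Fin N → Fin d → ℝ, energy z w m ≤ energy z w xs → m = xs := fun m hm =>
    sub_eq_zero.1 (eq_zero_of_energy w hpsd _ (by linarith [hE m xs hxs]))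
  refine ⟨xs, hmin, fun m hm => huniq m (hm xs), ?_⟩
  have hdec : ∀ x, energy z w (sweep z w x) ≤ energy z w x := fun x =>
    (foldl_energy z w hpsd hsymm _ x).1
  have hstrict : ∀ x, energy z w (sweep z w x) = energy z w x → x = xs := by
    intro x hx
    have hc := (foldl_energy z w hpsd hsymm _ x).2 hx
    refine huniq x ?_
    linarith [hE xs x (fun i => hc i (List.mem_finRange i)), energy_zero_nonneg w hpsd (xs - x)]
  have hanti : Antitone (fun t : ℕ => energy z w ((sweep z w)^[t] x0)) := by
    refine antitone_nat_of_succ_le fun t => ?_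
    rw [Function.iterate_succ_apply']
    exact hdec _
  have hlim := tendsto_atTop_ciInf hanti ⟨energy z w xs, by rintro _ ⟨t, rfl⟩; exact hmin _⟩
  set c := ⨅ t : ℕ, energy z w ((sweep z w)^[t] x0)
  set C := energy z w x0 with hC
  have hK : IsCompact (Set.pi Set.univ fun i : Fin N => Set.pi Set.univ fun k : Fin d =>
      Set.Icc (z i k - (C + 1)) (z i k + (C + 1))) :=
    isCompact_univ_pi fun i => isCompact_univ_pi fun k => isCompact_Icc
  refine hK.tendsto_nhds_of_unique_mapClusterPt (Filter.Eventually.of_forall fun t => ?_) ?_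
  · intro i _ k _
    have h1 := coord_sq_le_energy z w hpsd ((sweep z w)^[t] x0) i k
    have h2 : energy z w ((sweep z w)^[t] x0) ≤ C := hanti (Nat.zero_le t)
    constructor <;> nlinarith
  · intro p _ hp
    apply hstrict
    have h1 : MapClusterPt (energy z w p) Filter.atTop
        (energy z w ∘ fun t : ℕ => (sweep z w)^[t] x0) :=
      hp.continuousAt_comp (continuous_energy z w).continuousAt
    have h2 : MapClusterPt (energy z w (sweep z w p)) Filter.atTop
        ((energy z w ∘ sweep z w) ∘ fun t : ℕ => (sweep z w)^[t] x0) :=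
      MapClusterPt.continuousAt_comp (f := energy z w ∘ sweep z w)
        ((continuous_energy z w).comp (continuous_sweep z w)).continuousAt hp
    have hlim2 : Filter.Tendsto ((energy z w ∘ sweep z w) ∘ fun t : ℕ => (sweep z w)^[t] x0)
        Filter.atTop (nhds c) := by
      have := (Filter.tendsto_add_atTop_iff_nat 1).2 hlim
      refine this.congr fun t => ?_
      simp only [Function.comp, Function.iterate_succ_apply']
    have e1 : energy z w p = c := by
      have : ClusterPt (energy z w p) (nhds c) := ClusterPt.mono h1 hlim
      by_contra hne
      exact this.ne (disjoint_iff.1 (disjoint_nhds_nhds.2 hne))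
    have e2 : energy z w (sweep z w p) = c := by
      have : ClusterPt (energy z w (sweep z w p)) (nhds c) := ClusterPt.mono h2 hlim2
      by_contra hne
      exact this.ne (disjoint_iff.1 (disjoint_nhds_nhds.2 hne))
    rw [e1, e2]
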